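/- arXiv:1512.09320 — 5 statements merged into one kernel-verified Lean document; each statement's English description precedes it below -/
import Mathlib

section
/- Let n ≥ 2 be an integer and r₀ > 0. Let w : ℝⁿ → ℝ and F : ℝⁿ → [0,∞) be continuous functions such that ∫_{{x : |x| ≥ r₀}} F(x)ⁿ e^{n·w(x)} dx < ∞. Then there exists a sequence r_i → ∞ such that ∫_{∂B(0,r_i)} F^{n-1} e^{(n-1)w} dσ → 0 as i → ∞, where dσ denotes the (n−1)-dimensional Hausdorff measure on the sphere ∂B(0,r_i) = {x ∈ ℝⁿ : |x| = r_i}. -/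
open MeasureTheory Metric Filter
open scoped ENNReal NNReal Topology

section HausdorffMeasure

variable {X : Type*} [MetricSpace X] [MeasurableSpace X] [BorelSpace X]

/-- If `μ` gives every ball of radius `ε ≤ 1` mass at least a multiple of `ε ^ d`, then the
`d`-dimensional Hausdorff measure is bounded by a multiple of `μ`. -/
theorem hausdorffMeasure_le_smul_of_le_closedBall [TopologicalSpace.SeparableSpace X]
    (μ : Measure X) [IsFiniteMeasure μ] {d : ℝ} (hd : 0 ≤ d) {C : ℝ≥0∞} (hCtop : C ≠ ∞)
    (hC : ∀ (x : X) (ε : ℝ), 0 < ε → ε ≤ 1 → ENNReal.ofReal ε ^ d ≤ C * μ (closedBall x ε)) :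
    (μH[d] : Measure X) ≤ (10 ^ d * C) • μ := by
  have hC10 : 10 ^ d * C ≠ ∞ :=
    ENNReal.mul_ne_top (ENNReal.rpow_ne_top_of_nonneg hd (by simp)) hCtop
  have hopen : ∀ (s U : Set X), IsOpen U → s ⊆ U → μH[d] s ≤ (10 ^ d * C) * μ U := by
    intro s U hU hsU
    have hcover : ∀ k : ℕ, ∃ (u : Set X) (ρ : X → ℝ), u.Countable ∧
        (∀ x ∈ u, 0 < ρ x ∧ ρ x ≤ 1 / ((k : ℝ) + 1) ∧ closedBall x (ρ x) ⊆ U) ∧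
        u.PairwiseDisjoint (fun x => closedBall x (ρ x)) ∧
        s ⊆ ⋃ x : u, closedBall (x : X) (5 * ρ x) := by
      intro k
      have hρ : ∀ x : X, ∃ ρ : ℝ, x ∈ s →
          0 < ρ ∧ ρ ≤ 1 / ((k : ℝ) + 1) ∧ closedBall x ρ ⊆ U := by
        intro x
        by_cases hx : x ∈ s
        · obtain ⟨ε, hε, hεU⟩ := nhds_basis_closedBall.mem_iff.1 (hU.mem_nhds (hsU hx))
          refine ⟨min ε (1 / ((k : ℝ) + 1)), fun _ => ⟨by positivity, min_le_right _ _, ?_⟩⟩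
          exact (closedBall_subset_closedBall (min_le_left _ _)).trans hεU
        · exact ⟨0, fun h => absurd h hx⟩
      choose ρ hρ using hρ
      obtain ⟨u, hus, hdisj, hu⟩ := Vitali.exists_disjoint_subfamily_covering_enlargement_closedBall
        s (fun x => x) ρ (1 / ((k : ℝ) + 1)) (fun x hx => (hρ x hx).2.1) 5 (by norm_num)
      refine ⟨u, ρ, ?_, fun x hx => hρ x (hus hx), hdisj, fun x hx => ?_⟩
      · refine hdisj.countable_of_nonempty_interior fun x hx => ⟨x, ?_⟩
        exact ball_subset_interior_closedBall (mem_ball_self (hρ x (hus hx)).1)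
      · obtain ⟨y, hy, hxy⟩ := hu x hx
        exact Set.mem_iUnion.2 ⟨⟨y, hy⟩, hxy (mem_closedBall_self (hρ x hx).1.le)⟩
    choose u ρ hcount hρ hdisj hsub using hcover
    have : ∀ k, Countable (u k) := fun k => (hcount k).to_subtype
    have hdiam : ∀ k (x : u k), ediam (closedBall (x : X) (5 * ρ k x))
        ≤ 10 * ENNReal.ofReal (ρ k x) := by
      intro k x
      have h0 : 0 ≤ 5 * ρ k x := by linarith [(hρ k x x.2).1]
      rw [← closedEBall_ofReal h0]
      refine ediam_closedEBall_le.trans (le_of_eq ?_)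
      rw [ENNReal.ofReal_mul (by norm_num), ← mul_assoc]
      norm_num
    refine (Measure.hausdorffMeasure_le_liminf_tsum (l := atTop) d s
      (fun k : ℕ => 10 * ENNReal.ofReal (1 / ((k : ℝ) + 1))) ?_
      (fun k (x : u k) => closedBall (x : X) (5 * ρ k x)) ?_ (.of_forall hsub)).trans ?_
    · have h := ENNReal.Tendsto.const_mul (a := 10)
        (ENNReal.tendsto_ofReal tendsto_one_div_add_atTop_nhds_zero_nat) (Or.inr (by simp))
      simpa using h
    · refine .of_forall fun k x => (hdiam k x).trans ?_
      gcongr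
      exact (hρ k x x.2).2.1
    · refine (liminf_le_liminf (v := fun _ : ℕ => (10 ^ d * C) * μ U)
        (.of_forall fun k => ?_)).trans (by simp)
      calc ∑' x : u k, ediam (closedBall (x : X) (5 * ρ k x)) ^ d
          ≤ ∑' x : u k, (10 ^ d * C) * μ (closedBall (x : X) (ρ k x)) := by
            refine ENNReal.tsum_le_tsum fun x => ?_
            obtain ⟨h0, h1, -⟩ := hρ k x x.2
            have hk : 1 / ((k : ℝ) + 1) ≤ 1 := by
              rw [div_le_one (by positivity)]
              linarith [k.cast_nonneg (α := ℝ)]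
            calc _ ≤ (10 * ENNReal.ofReal (ρ k x)) ^ d := by gcongr; exact hdiam k x
              _ = 10 ^ d * ENNReal.ofReal (ρ k x) ^ d := ENNReal.mul_rpow_of_nonneg _ _ hd
              _ ≤ 10 ^ d * (C * μ (closedBall (x : X) (ρ k x))) := by
                gcongr; exact hC x _ h0 (h1.trans hk)
              _ = _ := (mul_assoc _ _ _).symm
        _ = (10 ^ d * C) * μ (⋃ x : u k, closedBall (x : X) (ρ k x)) := by
            rw [ENNReal.tsum_mul_left, measure_iUnion _ fun _ => isClosed_closedBall.measurableSet]
            exact fun x y hxy => hdisj k x.2 y.2 (Subtype.coe_injective.ne hxy)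
        _ ≤ (10 ^ d * C) * μ U := by
            gcongr
            exact Set.iUnion_subset fun x => (hρ k x x.2).2.2
  refine Measure.le_iff.2 fun s _ => ?_
  have hdiv : μH[d] s / (10 ^ d * C) ≤ μ s := by
    refine le_of_forall_gt fun b hb => ?_
    obtain ⟨U, hsU, hU, hUb⟩ := s.exists_isOpen_lt_of_lt b hb
    exact (ENNReal.div_le_of_le_mul' (hopen s U hU hsU)).trans_lt hUb
  rwa [ENNReal.div_le_iff_le_mul (.inr (measure_ne_top μ s)) (.inl hC10), mul_comm] at hdiv

end HausdorffMeasure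

section Polar

variable {E : Type*} [NormedAddCommGroup E] [NormedSpace ℝ E] [FiniteDimensional ℝ E]
  [Nontrivial E] [MeasurableSpace E] [BorelSpace E] (μ : Measure E) [μ.IsAddHaarMeasure]

/-- Integration in polar coordinates. -/
theorem lintegral_eq_lintegral_toSphere {g : E → ℝ≥0∞} (hg : Measurable g) :
    ∫⁻ x, g x ∂μ = ∫⁻ r in Set.Ioi (0 : ℝ), ENNReal.ofReal (r ^ (Module.finrank ℝ E - 1)) *
      ∫⁻ θ : sphere (0 : E) 1, g (r • (θ : E)) ∂μ.toSphere := by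
  have hgm : Measurable fun p : sphere (0 : E) 1 × Set.Ioi (0 : ℝ) =>
      g ((p.2 : ℝ) • (p.1 : E)) := hg.comp (by fun_prop)
  have hJ : Measurable fun r : ℝ => ∫⁻ θ : sphere (0 : E) 1, g (r • (θ : E)) ∂μ.toSphere :=
    Measurable.lintegral_prod_right' (f := fun p : ℝ × sphere (0 : E) 1 => g (p.1 • (p.2 : E)))
      (hg.comp (by fun_prop))
  have hpolar := μ.measurePreserving_homeomorphUnitSphereProd.lintegral_comp hgm
  have hinv : ∀ x : ({0}ᶜ : Set E), g (((homeomorphUnitSphereProd E x).2 : ℝ) •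
      ((homeomorphUnitSphereProd E x).1 : E)) = g x := by
    intro x
    have hx : ‖(x : E)‖ ≠ 0 := norm_ne_zero_iff.2 x.2
    simp [smul_smul, hx]
  simp only [hinv] at hpolar
  rw [lintegral_subtype_comap (measurableSet_singleton _).compl g,
    restrict_compl_singleton, lintegral_prod_symm _ hgm.aemeasurable] at hpolar
  rw [hpolar, Measure.volumeIoiPow]
  refine (lintegral_withDensity_eq_lintegral_mul _ (by fun_prop)
    (hJ.comp measurable_subtype_coe)).trans ?_
  exact lintegral_subtype_comap measurableSet_Ioi fun r : ℝ =>
    ENNReal.ofReal (r ^ (Module.finrank ℝ E - 1)) *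
      ∫⁻ θ : sphere (0 : E) 1, g (r • (θ : E)) ∂μ.toSphere

/-- Balls of radius `ε` in the unit sphere have surface measure at least of order
`ε ^ (dim E - 1)`. -/
theorem ofReal_pow_le_mul_toSphere_closedBall (x : sphere (0 : E) 1) {ε : ℝ} (hε : 0 < ε)
    (hε1 : ε ≤ 1) :
    ENNReal.ofReal ε ^ (Module.finrank ℝ E - 1) ≤
      (μ (ball 0 1))⁻¹ * 4 ^ Module.finrank ℝ E * μ.toSphere (closedBall x ε) := by
  set N := Module.finrank ℝ E with hN
  have hNpos : 0 < N := Module.finrank_pos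
  have hx : ‖(x : E)‖ = 1 := by simp
  have hsupp : ∀ r ∈ Set.Ioi (0 : ℝ), ENNReal.ofReal (r ^ (N - 1)) *
      ∫⁻ θ : sphere (0 : E) 1, (ball (x : E) (ε / 2)).indicator 1 (r • (θ : E)) ∂μ.toSphere ≤
      (Set.Ioo (1 - ε / 2) (1 + ε / 2)).indicator
        (fun _ => 2 ^ (N - 1) * μ.toSphere (closedBall x ε)) r := by
    intro r hr
    have hr0 : 0 < r := hr
    have hdist : ∀ θ : sphere (0 : E) 1, r • (θ : E) ∈ ball (x : E) (ε / 2) →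
        |r - 1| < ε / 2 ∧ θ ∈ closedBall x ε := by
      intro θ hθ
      have hθ1 : ‖(θ : E)‖ = 1 := by simp
      rw [mem_ball, dist_eq_norm] at hθ
      have h1 : |r - 1| < ε / 2 := by
        have := abs_norm_sub_norm_le (r • (θ : E)) x
        rw [norm_smul, hθ1, hx, mul_one, Real.norm_of_nonneg hr0.le] at this
        linarith
      refine ⟨h1, ?_⟩
      rw [mem_closedBall, Subtype.dist_eq, dist_eq_norm]
      have h2 : (θ : E) - x = (1 - r) • (θ : E) + (r • (θ : E) - x) := by module
      have h3 := norm_add_le ((1 - r) • (θ : E)) (r • (θ : E) - x)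
      rw [← h2, norm_smul, hθ1, mul_one, Real.norm_eq_abs, abs_sub_comm] at h3
      linarith
    by_cases hmem : r ∈ Set.Ioo (1 - ε / 2) (1 + ε / 2)
    · rw [Set.indicator_of_mem hmem]
      gcongr
      · rw [ENNReal.ofReal_pow hr0.le]
        gcongr
        rw [← ENNReal.ofReal_ofNat]
        exact ENNReal.ofReal_le_ofReal (by linarith [hmem.2])
      · calc _ ≤ ∫⁻ θ : sphere (0 : E) 1, (closedBall x ε).indicator 1 θ ∂μ.toSphere := by
              refine lintegral_mono fun θ => ?_
              by_cases hθ : r • (θ : E) ∈ ball (x : E) (ε / 2)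
              · simp [Set.indicator_of_mem hθ, Set.indicator_of_mem (hdist θ hθ).2]
              · simp [Set.indicator_of_notMem hθ]
          _ = _ := lintegral_indicator_one isClosed_closedBall.measurableSet
    · rw [Set.indicator_of_notMem hmem, nonpos_iff_eq_zero, mul_eq_zero]
      right
      refine (lintegral_congr fun θ => Set.indicator_of_notMem (fun hθ => hmem ?_) _).trans
        lintegral_zero
      have := abs_lt.1 (hdist θ hθ).1
      exact ⟨by linarith, by linarith⟩
  have hball : ENNReal.ofReal (ε / 2) ^ N * μ (ball 0 1) ≤
      2 ^ (N - 1) * μ.toSphere (closedBall x ε) * ENNReal.ofReal ε := by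
    calc ENNReal.ofReal (ε / 2) ^ N * μ (ball 0 1) = μ (ball (x : E) (ε / 2)) := by
          rw [μ.addHaar_ball_of_pos _ (half_pos hε), ENNReal.ofReal_pow (half_pos hε).le]
      _ = ∫⁻ y, (ball (x : E) (ε / 2)).indicator 1 y ∂μ :=
          (lintegral_indicator_one measurableSet_ball).symm
      _ ≤ ∫⁻ r in Set.Ioi (0 : ℝ), (Set.Ioo (1 - ε / 2) (1 + ε / 2)).indicator
            (fun _ => 2 ^ (N - 1) * μ.toSphere (closedBall x ε)) r := by
          rw [lintegral_eq_lintegral_toSphere μ (measurable_one.indicator measurableSet_ball)]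
          exact setLIntegral_mono' measurableSet_Ioi hsupp
      _ ≤ ∫⁻ r, (Set.Ioo (1 - ε / 2) (1 + ε / 2)).indicator
            (fun _ => 2 ^ (N - 1) * μ.toSphere (closedBall x ε)) r := setLIntegral_le_lintegral _ _
      _ = _ := by
          rw [lintegral_indicator_const measurableSet_Ioo, Real.volume_Ioo]
          congr 2
          ring
  have hB0 : μ (ball 0 1) ≠ 0 := (measure_ball_pos μ 0 one_pos).ne'
  have hBtop : μ (ball (0 : E) 1) ≠ ∞ := measure_ball_lt_top.ne
  have hε0 : ENNReal.ofReal ε ≠ 0 := by simpa using hε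
  have hhalf : ENNReal.ofReal ε = 2 * ENNReal.ofReal (ε / 2) := by
    rw [← ENNReal.ofReal_ofNat 2, ← ENNReal.ofReal_mul (by norm_num)]
    congr 1
    ring
  have hmul : ENNReal.ofReal ε * (μ (ball 0 1) * ENNReal.ofReal ε ^ (N - 1)) ≤
      ENNReal.ofReal ε * (4 ^ N * μ.toSphere (closedBall x ε)) := by
    calc ENNReal.ofReal ε * (μ (ball 0 1) * ENNReal.ofReal ε ^ (N - 1))
        = ENNReal.ofReal ε ^ (N - 1 + 1) * μ (ball 0 1) := by ring
      _ = 2 ^ N * (ENNReal.ofReal (ε / 2) ^ N * μ (ball 0 1)) := by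
          rw [Nat.sub_add_cancel hNpos, hhalf, mul_pow, mul_assoc]
      _ ≤ 2 ^ N * (2 ^ N * μ.toSphere (closedBall x ε) * ENNReal.ofReal ε) := by
          grw [hball]
          gcongr
          · norm_num
          · omega
      _ = (2 * 2) ^ N * μ.toSphere (closedBall x ε) * ENNReal.ofReal ε := by
          rw [mul_pow]; ring
      _ = _ := by norm_num; ring
  rw [ENNReal.mul_le_mul_iff_right hε0 ENNReal.ofReal_ne_top] at hmul
  rw [mul_assoc, ← ENNReal.div_eq_inv_mul, ENNReal.le_div_iff_mul_le (.inl hB0) (.inl hBtop),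
    mul_comm]
  exact hmul

/-- On the unit sphere, the Hausdorff measure of codimension one is bounded by a multiple of the
surface measure induced by a Haar measure. -/
theorem exists_hausdorffMeasure_sphere_le_smul_toSphere :
    ∃ C : ℝ≥0∞, C ≠ ∞ ∧
      (μH[(Module.finrank ℝ E : ℝ) - 1] : Measure (sphere (0 : E) 1)) ≤ C • μ.toSphere := by
  have hNpos : 1 ≤ Module.finrank ℝ E := Module.finrank_pos
  have hcast : (Module.finrank ℝ E : ℝ) - 1 = ((Module.finrank ℝ E - 1 : ℕ) : ℝ) := by
    rw [Nat.cast_sub hNpos, Nat.cast_one]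
  rw [hcast]
  have hCtop : (μ (ball 0 1))⁻¹ * 4 ^ Module.finrank ℝ E ≠ ∞ :=
    ENNReal.mul_ne_top (ENNReal.inv_ne_top.2 (measure_ball_pos μ 0 one_pos).ne')
      (ENNReal.pow_ne_top (by simp))
  refine ⟨_, ENNReal.mul_ne_top (ENNReal.rpow_ne_top_of_nonneg (Nat.cast_nonneg _) (by simp)) hCtop,
    hausdorffMeasure_le_smul_of_le_closedBall μ.toSphere (Nat.cast_nonneg _) hCtop
      fun x ε hε hε1 => ?_⟩
  rw [ENNReal.rpow_natCast]
  exact ofReal_pow_le_mul_toSphere_closedBall μ x hε hε1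

end Polar

/-- Rescaling an integral over a sphere to the unit sphere. -/
theorem setLIntegral_sphere_hausdorffMeasure_le {E : Type*} [NormedAddCommGroup E]
    [NormedSpace ℝ E] [MeasurableSpace E] [BorelSpace E] {d : ℝ} (hd : 0 ≤ d) {r : ℝ} (hr : 0 < r)
    {g : E → ℝ≥0∞} (hg : Measurable g) :
    ∫⁻ x in sphere (0 : E) r, g x ∂μH[d] ≤
      ENNReal.ofReal r ^ d * ∫⁻ θ : sphere (0 : E) 1, g (r • (θ : E)) ∂μH[d] := by
  have hf : Measurable fun θ : sphere (0 : E) 1 => r • (θ : E) := by fun_prop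
  have hlip : LipschitzWith r.toNNReal fun θ : sphere (0 : E) 1 => r • (θ : E) := by
    refine LipschitzWith.of_dist_le_mul fun a b => ?_
    rw [dist_smul₀, Real.norm_of_nonneg hr.le, Real.coe_toNNReal _ hr.le, Subtype.dist_eq]
  have hle : (μH[d] : Measure E).restrict (sphere 0 r) ≤ ENNReal.ofReal r ^ d •
      (μH[d] : Measure (sphere (0 : E) 1)).map
        (fun θ : sphere (0 : E) 1 => r • (θ : E)) := by
    refine Measure.le_iff.2 fun A hA => ?_
    rw [Measure.restrict_apply hA, Measure.smul_apply, Measure.map_apply hf hA, smul_eq_mul]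
    refine (measure_mono fun y hy => ?_).trans (hlip.hausdorffMeasure_image_le hd _)
    have hy' : ‖y‖ = r := by simpa using hy.2
    refine ⟨⟨r⁻¹ • y, by simp [norm_smul, hy', abs_of_pos hr, hr.ne']⟩, ?_, ?_⟩
    · simpa [smul_smul, hr.ne'] using hy.1
    · simp [smul_smul, hr.ne']
  refine (lintegral_mono' hle le_rfl).trans (le_of_eq ?_)
  rw [lintegral_smul_measure, smul_eq_mul, lintegral_map hg hf]

/-- An integrable function on a half-line is at most `ε / r` for arbitrarily large `r`. -/
theorem exists_gt_le_ofReal_div_of_lintegral_ne_top {φ : ℝ → ℝ≥0∞} {a : ℝ}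
    (hφ : ∫⁻ r in Set.Ioi a, φ r ≠ ∞) {ε : ℝ} (hε : 0 < ε) (R : ℝ) :
    ∃ r > R, φ r ≤ ENNReal.ofReal (ε / r) := by
  by_contra! h
  refine not_integrableOn_Ioi_inv (a := max (max a R) 0) ?_
  have hint : IntegrableOn (fun r : ℝ => ε / r) (Set.Ioi (max (max a R) 0)) := by
    refine ⟨by fun_prop, ?_⟩
    rw [hasFiniteIntegral_iff_ofReal]
    · refine lt_of_le_of_lt ?_ (lt_top_iff_ne_top.2 hφ)
      refine (setLIntegral_mono' measurableSet_Ioi fun r hr => (h r ?_).le).trans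
        (lintegral_mono_set (Set.Ioi_subset_Ioi ?_))
      · exact lt_of_le_of_lt ((le_max_right a R).trans (le_max_left _ _)) hr
      · exact (le_max_left a R).trans (le_max_left _ _)
    · filter_upwards [ae_restrict_mem measurableSet_Ioi] with r hr
      exact div_nonneg hε.le ((le_max_right _ _).trans (le_of_lt hr))
  refine (hint.const_mul ε⁻¹).congr (.of_forall fun r => ?_)
  simp only
  field_simp

/-- A weighted form of Young's inequality between consecutive powers. -/
theorem pow_le_mul_pow_succ_add_inv_pow {t a : ℝ} (ht : 0 ≤ t) (ha : 0 < a) (m : ℕ) :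
    t ^ m ≤ a * t ^ (m + 1) + a⁻¹ ^ m := by
  rcases le_total t a⁻¹ with h | h
  · have : t ^ m ≤ a⁻¹ ^ m := by gcongr
    have : 0 ≤ a * t ^ (m + 1) := by positivity
    linarith
  · have h1 : 1 ≤ a * t := by
      rwa [inv_le_iff_one_le_mul₀' ha] at h
    have h2 : 0 ≤ a⁻¹ ^ m := by positivity
    have h3 : 1 * t ^ m ≤ (a * t) * t ^ m := by gcongr
    rw [pow_succ']
    linarith

/-- If `G ^ (m + 1)` is integrable outside a ball of an `(m + 1)`-dimensional space, then there are
arbitrarily large spheres on which the integrals of `G ^ m` tend to zero. -/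
theorem exists_tendsto_setIntegral_sphere_pow {E : Type*} [NormedAddCommGroup E]
    [NormedSpace ℝ E] [FiniteDimensional ℝ E] [MeasurableSpace E] [BorelSpace E]
    (μ : Measure E) [μ.IsAddHaarMeasure] {m : ℕ} (hdim : Module.finrank ℝ E = m + 1) (hm : 1 ≤ m)
    {G : E → ℝ} (hGc : Continuous G) (hG0 : ∀ x, 0 ≤ G x) {r₀ : ℝ} (hr₀ : 0 < r₀)
    (hint : IntegrableOn (fun x => G x ^ (m + 1)) {x : E | r₀ ≤ ‖x‖} μ) :
    ∃ r : ℕ → ℝ, Tendsto r atTop atTop ∧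
      Tendsto (fun i => ∫ x in sphere (0 : E) (r i), G x ^ m ∂μH[(m : ℝ)]) atTop (𝓝 0) := by
  have : Nontrivial E := Module.nontrivial_of_finrank_pos (R := ℝ) (by omega)
  set σ : Measure (sphere (0 : E) 1) := μ.toSphere with hσ
  obtain ⟨C, hCtop, hC⟩ := exists_hausdorffMeasure_sphere_le_smul_toSphere μ
  rw [hdim, Nat.cast_add_one, add_sub_cancel_right] at hC
  set H : E → ℝ≥0∞ := fun x => ENNReal.ofReal (G x ^ (m + 1)) with hH
  have hHm : Measurable H := by fun_prop
  have hset : MeasurableSet {x : E | r₀ ≤ ‖x‖} :=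
    (isClosed_le continuous_const continuous_norm).measurableSet
  have hradial : ∫⁻ r in Set.Ioi r₀, ENNReal.ofReal (r ^ m) *
      ∫⁻ θ : sphere (0 : E) 1, H (r • (θ : E)) ∂σ ≠ ∞ := by
    have hfin : ∫⁻ x in {x : E | r₀ ≤ ‖x‖}, H x ∂μ < ∞ :=
      (hasFiniteIntegral_iff_ofReal (.of_forall fun x => pow_nonneg (hG0 x) _)).1 hint.2
    rw [← lintegral_indicator hset, lintegral_eq_lintegral_toSphere _ (hHm.indicator hset),
      hdim] at hfin
    refine (lt_of_le_of_lt ?_ hfin).ne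
    refine le_trans ?_ (lintegral_mono_set (Set.Ioi_subset_Ioi hr₀.le))
    refine setLIntegral_mono' measurableSet_Ioi fun r hr => ?_
    simp only [Nat.add_sub_cancel]
    gcongr with θ
    have hrpos : 0 < r := hr₀.trans hr
    have hmem : r • (θ : E) ∈ {x : E | r₀ ≤ ‖x‖} := by
      simpa [norm_smul, abs_of_pos hrpos] using (le_of_lt hr : r₀ ≤ r)
    rw [Set.indicator_of_mem hmem]
  have hbound : ∀ (r M : ℝ), 0 < r → 0 < M →
      ∫⁻ x in sphere (0 : E) r, ENNReal.ofReal (G x ^ m) ∂μH[(m : ℝ)] ≤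
      C * (ENNReal.ofReal (M * r) *
        (ENNReal.ofReal (r ^ m) * ∫⁻ θ : sphere (0 : E) 1, H (r • (θ : E)) ∂σ) +
        ENNReal.ofReal (M⁻¹ ^ m) * σ Set.univ) := by
    intro r M hr hM
    calc _ ≤ ENNReal.ofReal r ^ (m : ℝ) *
          ∫⁻ θ : sphere (0 : E) 1, ENNReal.ofReal (G (r • (θ : E)) ^ m) ∂μH[(m : ℝ)] :=
          setLIntegral_sphere_hausdorffMeasure_le (Nat.cast_nonneg _) hr (by fun_prop)
      _ ≤ ENNReal.ofReal (r ^ m) *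
          ∫⁻ θ : sphere (0 : E) 1, (ENNReal.ofReal (M * r) * H (r • (θ : E)) +
            ENNReal.ofReal ((M * r)⁻¹ ^ m)) ∂(C • σ) := by
          rw [ENNReal.rpow_natCast, ENNReal.ofReal_pow hr.le]
          refine mul_le_mul_right (lintegral_mono' hC fun θ => ?_) _
          rw [hH, ← ENNReal.ofReal_mul (by positivity), ← ENNReal.ofReal_add
            (mul_nonneg (by positivity) (pow_nonneg (hG0 _) _)) (by positivity)]
          exact ENNReal.ofReal_le_ofReal
            (pow_le_mul_pow_succ_add_inv_pow (hG0 _) (by positivity) m)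
      _ = C * (ENNReal.ofReal (M * r) *
          (ENNReal.ofReal (r ^ m) * ∫⁻ θ : sphere (0 : E) 1, H (r • (θ : E)) ∂σ) +
          (ENNReal.ofReal (r ^ m) * ENNReal.ofReal ((M * r)⁻¹ ^ m)) * σ Set.univ) := by
          rw [lintegral_smul_measure, smul_eq_mul, lintegral_add_right _ measurable_const,
            lintegral_const, lintegral_const_mul' _ _ ENNReal.ofReal_ne_top]
          ring
      _ = _ := by
          rw [← ENNReal.ofReal_mul (by positivity), ← mul_pow]
          congr 5
          field_simp
  have hseq : ∀ k : ℕ, ∃ r : ℝ, (k : ℝ) < r ∧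
      ∫⁻ x in sphere (0 : E) r, ENNReal.ofReal (G x ^ m) ∂μH[(m : ℝ)] ≤
      C * (1 + σ Set.univ) * ENNReal.ofReal (1 / ((k : ℝ) + 1)) := by
    intro k
    set M : ℝ := (k : ℝ) + 1 with hM
    have hM1 : 1 ≤ M := by linarith [k.cast_nonneg (α := ℝ)]
    have hM0 : 0 < M := by linarith
    obtain ⟨r, hkr, hr⟩ := exists_gt_le_ofReal_div_of_lintegral_ne_top hradial
      (ε := 1 / M ^ 2) (by positivity) (k : ℝ)
    have hr0 : 0 < r := lt_of_le_of_lt k.cast_nonneg hkr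
    refine ⟨r, hkr, (hbound r M hr0 hM0).trans ?_⟩
    have h1 : ENNReal.ofReal (M * r) * ENNReal.ofReal (1 / M ^ 2 / r) =
        ENNReal.ofReal (1 / M) := by
      rw [← ENNReal.ofReal_mul (by positivity)]
      congr 1
      field_simp
    have h2 : ENNReal.ofReal (M⁻¹ ^ m) ≤ ENNReal.ofReal (1 / M) := by
      rw [one_div]
      exact ENNReal.ofReal_le_ofReal
        (pow_le_of_le_one (by positivity) (inv_le_one_of_one_le₀ hM1) (by omega))
    grw [hr, h1, h2]
    exact le_of_eq (by ring)
  choose r hkr hr using hseq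
  refine ⟨r, tendsto_atTop_mono (fun k => (hkr k).le) tendsto_natCast_atTop_atTop, ?_⟩
  rw [tendsto_zero_iff_enorm_tendsto_zero]
  have hlim : Tendsto (fun k : ℕ => C * (1 + σ Set.univ) * ENNReal.ofReal (1 / ((k : ℝ) + 1)))
      atTop (𝓝 0) := by
    have h := ENNReal.Tendsto.const_mul (a := C * (1 + σ Set.univ))
      (ENNReal.tendsto_ofReal tendsto_one_div_add_atTop_nhds_zero_nat)
      (Or.inr (ENNReal.mul_ne_top hCtop (by simp)))
    simpa using h
  refine tendsto_of_tendsto_of_tendsto_of_le_of_le tendsto_const_nhds hlim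
    (fun _ => zero_le) fun k => ?_
  refine (enorm_integral_le_lintegral_enorm _).trans (le_trans (le_of_eq ?_) (hr k))
  exact lintegral_congr fun x => Real.enorm_of_nonneg (pow_nonneg (hG0 x) _)

/-- Lemma 3.2 (Euclidean content): existence of spheres on which the boundary
integral of `F^{n-1} e^{(n-1)w}` tends to zero. -/
theorem stmt_0 (n : ℕ) (hn : 2 ≤ n) (r₀ : ℝ) (hr₀ : 0 < r₀)
    (w F : EuclideanSpace ℝ (Fin n) → ℝ)
    (hw : Continuous w) (hF : Continuous F) (hFnonneg : ∀ x, 0 ≤ F x)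
    (hint : IntegrableOn (fun x => F x ^ n * Real.exp ((n : ℝ) * w x))
      {x : EuclideanSpace ℝ (Fin n) | r₀ ≤ ‖x‖}) :
    ∃ r : ℕ → ℝ, Tendsto r atTop atTop ∧
      Tendsto (fun i =>
        ∫ x in sphere (0 : EuclideanSpace ℝ (Fin n)) (r i),
          F x ^ (n - 1) * Real.exp (((n : ℝ) - 1) * w x) ∂(μH[(n : ℝ) - 1]))
        atTop (nhds 0) := by
  obtain ⟨m, rfl⟩ : ∃ m, n = m + 1 := ⟨n - 1, by omega⟩
  have hpow : ∀ (k : ℕ) x, F x ^ k * Real.exp (k * w x) = (F x * Real.exp (w x)) ^ k :=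
    fun k x => by rw [mul_pow, Real.exp_nat_mul]
  have hcast : ((m + 1 : ℕ) : ℝ) - 1 = m := by push_cast; ring
  simp only [hcast, Nat.add_sub_cancel, hpow] at hint ⊢
  exact exists_tendsto_setIntegral_sphere_pow volume (by simp) (by omega) (by fun_prop)
    (fun x => mul_nonneg (hFnonneg x) (Real.exp_pos _).le) hr₀ hint
end

section
/- Let P ∈ L¹(ℝ⁴) and define u(x) = ∫_{ℝ⁴} |P(y)| / |x − y| dy for x ∈ ℝ⁴. Then there exists a universal constant C such that for every ρ > 0, ∫_{{x : ρ ≤ |x| ≤ 2ρ}} u(x)² dx ≤ C ‖P‖_{L¹}² ρ². -/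
open MeasureTheory

open scoped ENNReal

/-- Cauchy–Schwarz for a weighted integral: `(∫ f k)² ≤ (∫ f) (∫ f k²)`. -/
theorem sq_lintegral_mul_le {α : Type*} [MeasurableSpace α] {μ : Measure α} {f k : α → ℝ≥0∞}
    (hf : AEMeasurable f μ) (hk : AEMeasurable k μ) :
    (∫⁻ y, f y * k y ∂μ) ^ 2 ≤ (∫⁻ y, f y ∂μ) * ∫⁻ y, f y * k y ^ 2 ∂μ := by
  have h := ENNReal.lintegral_mul_norm_pow_le (μ := μ) hf (hf.mul (hk.pow_const 2))
    (p := 1 / 2) (q := 1 / 2) (by norm_num) (by norm_num) (by norm_num)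
  have hpt (a b : ℝ≥0∞) : a ^ (1 / 2 : ℝ) * (a * b ^ 2) ^ (1 / 2 : ℝ) = a * b := by
    rw [← ENNReal.mul_rpow_of_nonneg _ _ (by norm_num),
      show a * (a * b ^ 2) = (a * b) ^ 2 by ring, ← ENNReal.rpow_natCast, ← ENNReal.rpow_mul]
    norm_num
  have hsq (a : ℝ≥0∞) : (a ^ (1 / 2 : ℝ)) ^ 2 = a := by
    rw [← ENNReal.rpow_natCast, ← ENNReal.rpow_mul]
    norm_num
  simp only [Pi.mul_apply, hpt] at h
  calc (∫⁻ y, f y * k y ∂μ) ^ 2 ≤ _ := pow_le_pow_left' h 2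
    _ = _ := by rw [mul_pow, hsq, hsq]

/-- In `ℝ⁴`, `∫_{|x| < ρ} |x|⁻² dx = 2 |B₁| ρ²`. -/
theorem setLIntegral_ball_inv_norm_sq {ρ : ℝ} (hρ : 0 < ρ) :
    ∫⁻ x in Metric.ball (0 : EuclideanSpace ℝ (Fin 4)) ρ, ENNReal.ofReal (‖x‖⁻¹ ^ 2) =
      ENNReal.ofReal (2 * volume.real (Metric.ball (0 : EuclideanSpace ℝ (Fin 4)) 1) * ρ ^ 2) := by
  have hcancel : ∀ r ∈ Set.Ioo 0 ρ, r ^ 3 * r⁻¹ ^ 2 = r := fun r hr => by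
    have := hr.1.ne'
    field_simp
  have hint : IntegrableOn (fun x : EuclideanSpace ℝ (Fin 4) => ‖x‖⁻¹ ^ 2)
      (Metric.ball 0 ρ) := by
    rw [integrableOn_fun_norm_addHaar volume (f := fun r : ℝ => r⁻¹ ^ 2)]
    simp only [finrank_euclideanSpace, Fintype.card_fin, smul_eq_mul]
    rw [integrableOn_congr_fun hcancel measurableSet_Ioo]
    exact (continuous_id.integrableOn_Icc (a := 0) (b := ρ)).mono_set Set.Ioo_subset_Icc_self
  rw [← ofReal_integral_eq_lintegral_ofReal hint (ae_of_all _ fun x => by positivity),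
    ← integral_indicator Metric.isOpen_ball.measurableSet]
  congr 1
  have h := integral_fun_norm_addHaar (volume : Measure (EuclideanSpace ℝ (Fin 4)))
    ((Set.Iio ρ).indicator fun r : ℝ => r⁻¹ ^ 2)
  have hradial : ∫ r in Set.Ioi (0 : ℝ), r ^ 3 * (Set.Iio ρ).indicator (fun r : ℝ => r⁻¹ ^ 2) r =
      ρ ^ 2 / 2 := by
    simp_rw [← Set.indicator_mul_right (Set.Iio ρ) (fun r : ℝ => r ^ 3)]
    rw [setIntegral_indicator measurableSet_Iio, Set.Ioi_inter_Iio,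
      setIntegral_congr_fun measurableSet_Ioo hcancel, ← integral_Ioc_eq_integral_Ioo,
      ← intervalIntegral.integral_of_le hρ.le, integral_id]
    ring
  simp only [finrank_euclideanSpace, Fintype.card_fin, smul_eq_mul, nsmul_eq_mul,
    Nat.add_one_sub_one, hradial] at h
  calc _ = ∫ x : EuclideanSpace ℝ (Fin 4), (Set.Iio ρ).indicator (fun r : ℝ => r⁻¹ ^ 2) ‖x‖ := by
        congr 1 with x
        simp [Set.indicator]
    _ = _ := by
        rw [h]
        push_cast
        ring

/-- The integral of `|x - y|⁻²` over a ball of radius `2ρ` in `ℝ⁴` is at most `18 |B₁| ρ²`,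
uniformly in `y`. -/
theorem setLIntegral_closedBall_inv_norm_sub_sq_le {ρ : ℝ} (hρ : 0 < ρ)
    (y : EuclideanSpace ℝ (Fin 4)) :
    ∫⁻ x in Metric.closedBall (0 : EuclideanSpace ℝ (Fin 4)) (2 * ρ),
        ENNReal.ofReal (‖x - y‖⁻¹ ^ 2) ≤
      ENNReal.ofReal
        (18 * volume.real (Metric.ball (0 : EuclideanSpace ℝ (Fin 4)) 1) * ρ ^ 2) := by
  set V := volume.real (Metric.ball (0 : EuclideanSpace ℝ (Fin 4)) 1) with hV
  have hV0 : 0 ≤ V := measureReal_nonneg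
  set g : EuclideanSpace ℝ (Fin 4) → ℝ≥0∞ :=
    (Metric.ball 0 ρ).indicator fun x => ENNReal.ofReal (‖x‖⁻¹ ^ 2) with hg
  have hgm : Measurable g :=
    Measurable.indicator (by fun_prop) Metric.isOpen_ball.measurableSet
  have hpt (x : EuclideanSpace ℝ (Fin 4)) :
      ENNReal.ofReal (‖x - y‖⁻¹ ^ 2) ≤ g (x - y) + ENNReal.ofReal (ρ⁻¹ ^ 2) := by
    by_cases h : ‖x - y‖ < ρ
    · simp [hg, h]
    · refine le_add_left (ENNReal.ofReal_le_ofReal ?_)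
      have := inv_anti₀ hρ (not_lt.mp h)
      gcongr
  have hvol : volume (Metric.closedBall (0 : EuclideanSpace ℝ (Fin 4)) (2 * ρ)) =
      ENNReal.ofReal ((2 * ρ) ^ 4 * V) := by
    rw [Measure.addHaar_closedBall _ _ (by positivity), ENNReal.ofReal_mul (by positivity), hV,
      ofReal_measureReal measure_ball_lt_top.ne]
    simp
  calc _ ≤ ∫⁻ x in Metric.closedBall 0 (2 * ρ), (g (x - y) + ENNReal.ofReal (ρ⁻¹ ^ 2)) :=
        lintegral_mono hpt
    _ = (∫⁻ x in Metric.closedBall 0 (2 * ρ), g (x - y)) +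
          ENNReal.ofReal (ρ⁻¹ ^ 2) * ENNReal.ofReal ((2 * ρ) ^ 4 * V) := by
        rw [lintegral_add_right _ measurable_const, setLIntegral_const, hvol]
    _ ≤ (∫⁻ x, g (x - y)) + ENNReal.ofReal (ρ⁻¹ ^ 2) * ENNReal.ofReal ((2 * ρ) ^ 4 * V) := by
        gcongr
        exact Measure.restrict_le_self
    _ = _ := by
        rw [lintegral_sub_right_eq_self, hg,
          lintegral_indicator Metric.isOpen_ball.measurableSet, setLIntegral_ball_inv_norm_sq hρ,
          ← ENNReal.ofReal_mul (by positivity), ← ENNReal.ofReal_add (by positivity) (by positivity)]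
        congr 1
        field_simp
        ring

/-- Inequality (3.1) and its consequence in the proof of Lemma 2.2: the L² norm of the
Riesz potential of an L¹ function over the annulus `ρ ≤ |x| ≤ 2ρ` in `ℝ⁴` is `O(ρ)`. -/
theorem stmt_5 :
    ∃ C : ℝ, 0 < C ∧
      ∀ (P : EuclideanSpace ℝ (Fin 4) → ℝ), Integrable P →
      ∀ (ρ : ℝ), 0 < ρ →
        (∫⁻ x in {x : EuclideanSpace ℝ (Fin 4) | ρ ≤ ‖x‖ ∧ ‖x‖ ≤ 2 * ρ},
            (∫⁻ y, ENNReal.ofReal (|P y| / ‖x - y‖)) ^ 2) ≤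
          ENNReal.ofReal (C * (∫ y, |P y|) ^ 2 * ρ ^ 2) := by
  set V := volume.real (Metric.ball (0 : EuclideanSpace ℝ (Fin 4)) 1)
  have hV : 0 < V :=
    ENNReal.toReal_pos (Metric.measure_ball_pos _ _ one_pos).ne' measure_ball_lt_top.ne
  refine ⟨18 * V, by positivity, fun P hP ρ hρ => ?_⟩
  set f : EuclideanSpace ℝ (Fin 4) → ℝ≥0∞ := fun y => ENNReal.ofReal |P y| with hf
  have hfm : AEMeasurable f := hP.abs.aemeasurable.ennreal_ofReal
  have hN : ∫⁻ y, f y = ENNReal.ofReal (∫ y, |P y|) :=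
    (ofReal_integral_eq_lintegral_ofReal hP.abs (ae_of_all _ fun _ => abs_nonneg _)).symm
  have hN0 : 0 ≤ ∫ y, |P y| := integral_nonneg fun _ => abs_nonneg _
  have hpt (x : EuclideanSpace ℝ (Fin 4)) :
      (∫⁻ y, ENNReal.ofReal (|P y| / ‖x - y‖)) ^ 2 ≤
        (∫⁻ y, f y) * ∫⁻ y, f y * ENNReal.ofReal (‖x - y‖⁻¹ ^ 2) := by
    have h := sq_lintegral_mul_le hfm
      (k := fun y => ENNReal.ofReal ‖x - y‖⁻¹) (by fun_prop)
    simpa only [hf, div_eq_mul_inv, ENNReal.ofReal_mul (abs_nonneg _),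
      ENNReal.ofReal_pow (inv_nonneg.mpr (norm_nonneg _))] using h
  calc _ ≤ ∫⁻ x in Metric.closedBall 0 (2 * ρ),
          (∫⁻ y, ENNReal.ofReal (|P y| / ‖x - y‖)) ^ 2 :=
        lintegral_mono_set fun x hx => mem_closedBall_zero_iff.mpr hx.2
    _ ≤ ∫⁻ x in Metric.closedBall 0 (2 * ρ),
          (∫⁻ y, f y) * ∫⁻ y, f y * ENNReal.ofReal (‖x - y‖⁻¹ ^ 2) := lintegral_mono hpt
    _ = (∫⁻ y, f y) * ∫⁻ y, f y * ∫⁻ x in Metric.closedBall 0 (2 * ρ),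
          ENNReal.ofReal (‖x - y‖⁻¹ ^ 2) := by
        rw [lintegral_const_mul' _ _ (hN ▸ ENNReal.ofReal_ne_top), lintegral_lintegral_swap]
        · congr 2 with y
          exact lintegral_const_mul' _ _ ENNReal.ofReal_ne_top
        · exact hfm.comp_snd.mul (by fun_prop)
    _ ≤ (∫⁻ y, f y) * ∫⁻ y, f y * ENNReal.ofReal (18 * V * ρ ^ 2) := by
        gcongr with y
        exact setLIntegral_closedBall_inv_norm_sub_sq_le hρ y
    _ = _ := by
        rw [lintegral_mul_const' _ _ ENNReal.ofReal_ne_top, hN,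
          ← ENNReal.ofReal_mul hN0, ← ENNReal.ofReal_mul hN0]
        congr 1
        ring
end

section
/- Let n ≥ 2 be an integer, b > 0 and q ≥ 1 real numbers with b·q < n − 1, and let P ∈ L¹(ℝⁿ). Define u(x) = ∫_{ℝⁿ} |P(y)| / |x − y|^{b} dy. Then there exists a constant C depending only on n, b and q such that for every r > 0, ∫_{∂B(0,r)} u(x)^{q} dσ(x) ≤ C ‖P‖_{L¹}^{q} r^{n−1−bq}, where dσ is the (n−1)-dimensional Hausdorff measure on the sphere ∂B(0,r). -/
open MeasureTheory Metric
open Set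
open scoped NNReal ENNReal

/-- A measure of upper growth of order `d` integrates the kernel `dist x y ^ (-s)`, `s < d`,
with a bound uniform in the pole `y`. -/
theorem lintegral_inv_dist_rpow_le {X : Type*} [PseudoMetricSpace X] [MeasurableSpace X]
    [OpensMeasurableSpace X] (μ : Measure X) {A d s r : ℝ} (hA : 0 ≤ A) (hs : 0 < s) (hsd : s < d)
    (hr : 0 < r) (y : X) (hball : ∀ t, 0 < t → μ (closedBall y t) ≤ ENNReal.ofReal (A * t ^ d))
    (huniv : μ univ ≤ ENNReal.ofReal (A * r ^ d)) :
    ∫⁻ x, ENNReal.ofReal ((dist x y ^ s)⁻¹) ∂μ ≤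
      ENNReal.ofReal (A * (1 + 2 ^ s * (1 - (1 / 2) ^ (d - s))⁻¹) * r ^ (d - s)) := by
  set ρ : ℕ → ℝ := fun k => r * (1 / 2) ^ k with hρ
  have hρ0 (k) : 0 < ρ k := by positivity
  have hpt (x : X) : ENNReal.ofReal ((dist x y ^ s)⁻¹) ≤ ENNReal.ofReal ((r ^ s)⁻¹) +
      ∑' k, (closedBall y (ρ k)).indicator (fun _ => ENNReal.ofReal ((ρ (k + 1) ^ s)⁻¹)) x := by
    rcases le_or_gt r (dist x y) with h | h
    · refine le_add_right (ENNReal.ofReal_le_ofReal ?_)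
      gcongr
    rcases dist_nonneg.eq_or_lt' (a := dist x y) with h0 | h0
    · simp [h0, Real.zero_rpow hs.ne']
    obtain ⟨k, hk1, hk2⟩ := exists_nat_pow_near_of_lt_one (div_pos h0 hr)
      ((div_le_one hr).2 h.le) (y := (1 / 2 : ℝ)) (by norm_num) (by norm_num)
    refine le_add_left (le_trans ?_ (ENNReal.le_tsum k))
    have hx : x ∈ closedBall y (ρ k) := by
      rw [mem_closedBall]
      simp only [hρ]
      rw [mul_comm]
      exact (div_le_iff₀ hr).1 hk2
    rw [indicator_of_mem hx]
    refine ENNReal.ofReal_le_ofReal (inv_anti₀ (Real.rpow_pos_of_pos (hρ0 _) _)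
      (Real.rpow_le_rpow (hρ0 _).le ?_ hs.le))
    simp only [hρ]
    rw [mul_comm]
    exact ((lt_div_iff₀ hr).1 hk1).le
  have hr_s : 0 < 1 - (1 / 2 : ℝ) ^ (d - s) :=
    sub_pos.2 (Real.rpow_lt_one (by norm_num) (by norm_num) (sub_pos.2 hsd))
  have hterm (k : ℕ) : (ρ (k + 1) ^ s)⁻¹ * (A * ρ k ^ d) =
      A * 2 ^ s * r ^ (d - s) * ((1 / 2 : ℝ) ^ (d - s)) ^ k := by
    have h1 : ρ (k + 1) = ρ k / 2 := by simp only [hρ]; ring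
    have h2 : ρ k ^ (d - s) = r ^ (d - s) * ((1 / 2 : ℝ) ^ (d - s)) ^ k := by
      rw [hρ, Real.mul_rpow hr.le (by positivity), ← Real.rpow_natCast, ← Real.rpow_natCast,
        ← Real.rpow_mul (by norm_num), ← Real.rpow_mul (by norm_num), mul_comm (d - s)]
    rw [mul_assoc _ _ (_ ^ k), ← h2, h1, Real.div_rpow (hρ0 k).le (by norm_num),
      Real.rpow_sub (hρ0 k)]
    field_simp
  calc ∫⁻ x, ENNReal.ofReal ((dist x y ^ s)⁻¹) ∂μ
      ≤ ∫⁻ x, ENNReal.ofReal ((r ^ s)⁻¹) + ∑' k, (closedBall y (ρ k)).indicator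
          (fun _ => ENNReal.ofReal ((ρ (k + 1) ^ s)⁻¹)) x ∂μ := lintegral_mono hpt
    _ = ENNReal.ofReal ((r ^ s)⁻¹) * μ univ +
          ∑' k, ENNReal.ofReal ((ρ (k + 1) ^ s)⁻¹) * μ (closedBall y (ρ k)) := by
        rw [lintegral_add_left measurable_const, lintegral_const, lintegral_tsum
          fun k => (measurable_const.indicator measurableSet_closedBall).aemeasurable]
        simp_rw [lintegral_indicator_const measurableSet_closedBall]
    _ ≤ ENNReal.ofReal ((r ^ s)⁻¹) * ENNReal.ofReal (A * r ^ d) +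
          ∑' k, ENNReal.ofReal ((ρ (k + 1) ^ s)⁻¹) * ENNReal.ofReal (A * ρ k ^ d) := by
        gcongr with k
        exact hball _ (hρ0 k)
    _ = ENNReal.ofReal (A * r ^ (d - s)) + ∑' k,
          ENNReal.ofReal (A * 2 ^ s * r ^ (d - s) * ((1 / 2 : ℝ) ^ (d - s)) ^ k) := by
        congr 1
        · rw [← ENNReal.ofReal_mul (by positivity), Real.rpow_sub hr]
          congr 1
          field_simp
        · congr with k
          rw [← ENNReal.ofReal_mul (by have := hρ0 (k + 1); positivity), hterm]
    _ = _ := by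
        have hg := hasSum_geometric_of_lt_one (r := (1 / 2 : ℝ) ^ (d - s)) (by positivity)
          (sub_pos.1 hr_s)
        rw [← ENNReal.ofReal_tsum_of_nonneg (fun k => by positivity) (hg.summable.mul_left _),
          tsum_mul_left, hg.tsum_eq, ← ENNReal.ofReal_add (by positivity) (by positivity)]
        congr 1
        ring

/-- Jensen's inequality for `t ↦ t ^ q` with respect to the weight `f`. -/
theorem rpow_lintegral_mul_le {α : Type*} [MeasurableSpace α] {μ : Measure α}
    {f g : α → ℝ≥0∞} (hf : AEMeasurable f μ) (hg : Measurable g) {q : ℝ} (hq : 1 ≤ q) :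
    (∫⁻ x, f x * g x ∂μ) ^ q ≤ (∫⁻ x, f x ∂μ) ^ (q - 1) * ∫⁻ x, f x * g x ^ q ∂μ := by
  have hq0 : 0 < q := by linarith
  have h := eLpNorm'_le_eLpNorm'_mul_rpow_measure_univ (μ := μ.withDensity f) one_pos hq
    hg.aestronglyMeasurable
  have hd (k : α → ENNReal) (hk : Measurable k) :
      ∫⁻ x, k x ∂μ.withDensity f = ∫⁻ x, f x * k x ∂μ :=
    lintegral_withDensity_eq_lintegral_mul₀ hf hk.aemeasurable
  simp only [eLpNorm', enorm_eq_self, ENNReal.rpow_one, div_one] at h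
  rw [hd _ hg, hd _ (hg.pow_const q), withDensity_apply _ .univ, setLIntegral_univ] at h
  calc _ ≤ _ := ENNReal.rpow_le_rpow h hq0.le
    _ = _ := by
      rw [ENNReal.mul_rpow_of_nonneg _ _ hq0.le, ← ENNReal.rpow_mul, ← ENNReal.rpow_mul,
        one_div_mul_cancel hq0.ne', ENNReal.rpow_one, mul_comm]
      congr 2
      field_simp

/-- A map which is antilipschitz on `s` controls the Hausdorff measure of `s` by that of its image. -/
theorem hausdorffMeasure_le_of_edist_le {X Y : Type*} [EMetricSpace X] [MeasurableSpace X]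
    [BorelSpace X] [EMetricSpace Y] [MeasurableSpace Y] [BorelSpace Y] {f : X → Y} {s : Set X}
    {K : ℝ≥0} (h : ∀ x ∈ s, ∀ y ∈ s, edist x y ≤ K * edist (f x) (f y)) {d : ℝ} (hd : 0 ≤ d) :
    μH[d] s ≤ (K : ℝ≥0∞) ^ d * μH[d] (f '' s) := by
  rcases s.eq_empty_or_nonempty with rfl | ⟨x₀, -⟩
  · simp
  have : Nonempty X := ⟨x₀⟩
  have hinj : InjOn f s := fun x hx y hy hxy => by
    simpa [hxy] using h x hx y hy
  have hlip : LipschitzOnWith K (Function.invFunOn f s) (f '' s) := by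
    rintro _ ⟨x, hx, rfl⟩ _ ⟨y, hy, rfl⟩
    rw [hinj.leftInvOn_invFunOn hx, hinj.leftInvOn_invFunOn hy]
    exact h x hx y hy
  have := hlip.hausdorffMeasure_image_le hd
  rwa [hinj.leftInvOn_invFunOn.image_image] at this

theorem dist_removeNth_le {m : ℕ} (i : Fin (m + 1)) (x y : EuclideanSpace ℝ (Fin (m + 1))) :
    dist (i.removeNth x.ofLp) (i.removeNth y.ofLp) ≤ dist x y := by
  refine (dist_pi_le_iff dist_nonneg).2 fun j => ?_
  rw [dist_eq_norm x y, Fin.removeNth, Fin.removeNth, dist_eq_norm]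
  exact PiLp.norm_apply_le (x - y) _

/-- On a spherical cap away from the equator `x i = 0`, forgetting the `i`-th coordinate is
antilipschitz. -/
theorem dist_le_mul_dist_removeNth {m : ℕ} {r c : ℝ} (hr : 0 < r) (hc : 0 ≤ c) (i : Fin (m + 1))
    {ε : ℝ} (hε : |ε| = 1) {x y : EuclideanSpace ℝ (Fin (m + 1))} (hx : ‖x‖ = r) (hy : ‖y‖ = r)
    (hxi : r ≤ c * (ε * x i)) (hyi : r ≤ c * (ε * y i)) :
    dist x y ≤ (c * m + m) * dist (i.removeNth x.ofLp) (i.removeNth y.ofLp) := by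
  set D := dist (i.removeNth x.ofLp) (i.removeNth y.ofLp)
  have hD0 : 0 ≤ D := dist_nonneg
  have hD (j : Fin m) : |x (i.succAbove j) - y (i.succAbove j)| ≤ D :=
    dist_le_pi_dist (i.removeNth x.ofLp) (i.removeNth y.ofLp) j
  have hxr (j) : |x j| ≤ r := hx ▸ PiLp.norm_apply_le x j
  have hyr (j) : |y j| ≤ r := hy ▸ PiLp.norm_apply_le y j
  have hx2 := EuclideanSpace.real_norm_sq_eq x
  have hy2 := EuclideanSpace.real_norm_sq_eq y
  rw [hx, Fin.sum_univ_succAbove _ i] at hx2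
  rw [hy, Fin.sum_univ_succAbove _ i] at hy2
  have hdiff : |x i ^ 2 - y i ^ 2| ≤ m * (D * (2 * r)) := by
    have : x i ^ 2 - y i ^ 2 = -∑ j, (x (i.succAbove j) - y (i.succAbove j)) *
        (x (i.succAbove j) + y (i.succAbove j)) := by
      have key (j) : (x (i.succAbove j) - y (i.succAbove j)) *
          (x (i.succAbove j) + y (i.succAbove j)) =
          x (i.succAbove j) ^ 2 - y (i.succAbove j) ^ 2 := by ring
      simp_rw [key, Finset.sum_sub_distrib]
      linarith
    rw [this, abs_neg]
    refine (Finset.abs_sum_le_sum_abs _ _).trans ((Finset.sum_le_card_nsmul _ _ (D * (2 * r))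
      fun j _ => ?_).trans_eq (by simp))
    rw [abs_mul]
    gcongr
    · exact hD j
    · linarith [abs_add_le (x (i.succAbove j)) (y (i.succAbove j)), hxr (i.succAbove j),
        hyr (i.succAbove j)]
  have hi : |x i - y i| ≤ c * m * D := by
    have h1 : 2 * r ≤ c * |x i + y i| := by
      have : ε * (x i + y i) ≤ |x i + y i| := by
        simpa [abs_mul, hε] using le_abs_self (ε * (x i + y i))
      nlinarith
    have h2 : |x i - y i| * |x i + y i| ≤ m * (D * (2 * r)) := by
      rwa [← abs_mul, mul_comm, ← sq_sub_sq]
    have h3 : |x i - y i| * (2 * r) ≤ c * m * D * (2 * r) := by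
      nlinarith [abs_nonneg (x i - y i)]
    exact le_of_mul_le_mul_right h3 (by positivity)
  rw [dist_eq_norm]
  refine abs_le_of_sq_le_sq' ?_ (by positivity) |>.2
  rw [EuclideanSpace.real_norm_sq_eq, Fin.sum_univ_succAbove _ i]
  have hsum : ∑ j, (x - y) (i.succAbove j) ^ 2 ≤ m * D ^ 2 := by
    refine (Finset.sum_le_card_nsmul _ _ (D ^ 2) fun j _ => ?_).trans_eq (by simp)
    rw [← sq_abs]
    exact pow_le_pow_left₀ (abs_nonneg _) (hD j) 2
  have hi2 : (x - y) i ^ 2 ≤ (c * m * D) ^ 2 := by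
    rw [← sq_abs]
    exact pow_le_pow_left₀ (abs_nonneg _) hi 2
  have hm : (m : ℝ) ≤ m ^ 2 := by exact_mod_cast Nat.le_self_pow two_ne_zero m
  have : 0 ≤ c * m * m * D ^ 2 := by positivity
  nlinarith [sq_nonneg D]

theorem exists_norm_le_mul_abs {m : ℕ} (x : EuclideanSpace ℝ (Fin (m + 1))) :
    ∃ i, ‖x‖ ≤ (m + 1) * |x i| := by
  by_contra! h
  have h0 := h 0
  have hpos : 0 < ‖x‖ := lt_of_le_of_lt (by positivity) h0
  have hlt : ∑ i, ((m + 1) * |x i|) ^ 2 < ∑ _i : Fin (m + 1), ‖x‖ ^ 2 :=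
    Finset.sum_lt_sum_of_nonempty Finset.univ_nonempty
      fun i _ => pow_lt_pow_left₀ (h i) (by positivity) two_ne_zero
  simp only [mul_pow, sq_abs, ← Finset.mul_sum, ← EuclideanSpace.real_norm_sq_eq,
    Finset.sum_const, Finset.card_univ, Fintype.card_fin, nsmul_eq_mul] at hlt
  push_cast at hlt
  have : (0 : ℝ) ≤ m * (m + 1) * ‖x‖ ^ 2 := by positivity
  nlinarith

/-- The surface measure of spheres has upper growth of order `m`, uniformly in the radius. -/
theorem hausdorffMeasure_sphere_inter_closedBall_le (m : ℕ) {r t : ℝ} (hr : 0 < r) (ht : 0 < t)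
    (y : EuclideanSpace ℝ (Fin (m + 1))) :
    μH[m] (sphere 0 r ∩ closedBall y t) ≤
      ENNReal.ofReal (2 * (m + 1) * (2 * ((m + 1) * m + m)) ^ m * t ^ (m : ℝ)) := by
  let K : ℝ≥0 := (m + 1) * m + m
  let cap (p : Fin (m + 1) × ℤˣ) : Set (EuclideanSpace ℝ (Fin (m + 1))) :=
    {x | x ∈ sphere 0 r ∩ closedBall y t ∧ r ≤ (m + 1) * (((p.2 : ℤ) : ℝ) * x p.1)}
  have hcover : sphere 0 r ∩ closedBall y t ⊆ ⋃ p, cap p := by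
    intro x hx
    obtain ⟨i, hi⟩ := exists_norm_le_mul_abs x
    rw [mem_sphere_zero_iff_norm.1 hx.1] at hi
    rcases abs_cases (x i) with h | h
    · exact mem_iUnion.2 ⟨(i, 1), hx, by simpa [h.1] using hi⟩
    · exact mem_iUnion.2 ⟨(i, -1), hx, by simpa [h.1] using hi⟩
  have hcap (p) : μH[m] (cap p) ≤ ENNReal.ofReal ((2 * ((m + 1) * m + m)) ^ m * t ^ m) := by
    have h := hausdorffMeasure_le_of_edist_le (f := fun x : EuclideanSpace ℝ (Fin (m + 1)) =>
      p.1.removeNth x.ofLp) (s := cap p) (K := K) (d := m) (fun x hx z hz => ?_) m.cast_nonneg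
    · refine h.trans ?_
      have hsub : (fun x : EuclideanSpace ℝ (Fin (m + 1)) => p.1.removeNth x.ofLp) '' cap p ⊆
          closedBall (p.1.removeNth y.ofLp) t := by
        rintro _ ⟨x, hx, rfl⟩
        exact (dist_removeNth_le _ _ _).trans hx.1.2
      have hH : (μH[(m : ℝ)] : Measure (Fin m → ℝ)) = volume := by
        simpa using hausdorffMeasure_pi_real (ι := Fin m)
      calc _ ≤ (K : ℝ≥0∞) ^ (m : ℝ) * ENNReal.ofReal ((2 * t) ^ m) := by
            gcongr
            refine (measure_mono hsub).trans_eq ?_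
            rw [hH, Real.volume_pi_closedBall _ ht.le, Fintype.card_fin]
        _ = _ := by
            rw [ENNReal.rpow_natCast, ← ENNReal.ofReal_coe_nnreal,
              ← ENNReal.ofReal_pow NNReal.zero_le_coe, ← ENNReal.ofReal_mul (by positivity)]
            congr 1
            simp only [K]
            push_cast
            rw [← mul_pow, ← mul_pow]
            ring
    · have hε : |((p.2 : ℤ) : ℝ)| = 1 := by
        rcases Int.units_eq_one_or p.2 with h | h <;> simp [h]
      have := dist_le_mul_dist_removeNth hr (by positivity) p.1 hε
        (mem_sphere_zero_iff_norm.1 hx.1.1) (mem_sphere_zero_iff_norm.1 hz.1.1) hx.2 hz.2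
      rw [edist_dist, edist_dist, ← ENNReal.ofReal_coe_nnreal,
        ← ENNReal.ofReal_mul NNReal.zero_le_coe]
      exact ENNReal.ofReal_le_ofReal (by simpa [K] using this)
  calc _ ≤ μH[m] (⋃ p, cap p) := measure_mono hcover
    _ ≤ ∑ p, μH[m] (cap p) := measure_iUnion_fintype_le _ _
    _ ≤ _ := Finset.sum_le_card_nsmul _ _ _ fun p _ => hcap p
    _ = _ := by
      rw [Finset.card_univ, Fintype.card_prod, Fintype.card_fin, Fintype.card_units_int,
        nsmul_eq_mul, ← ENNReal.ofReal_natCast, ← ENNReal.ofReal_mul (by positivity),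
        Real.rpow_natCast]
      congr 1
      push_cast
      ring

/-- The sphere estimate (4.3)–(4.4) in the proof of Lemma 5.2. -/
theorem stmt_6 (n : ℕ) (hn : 2 ≤ n) (b q : ℝ) (hb : 0 < b) (hq : 1 ≤ q)
    (hbq : b * q < (n : ℝ) - 1) :
    ∃ C : ℝ, 0 < C ∧
      ∀ (P : EuclideanSpace ℝ (Fin n) → ℝ), Integrable P →
      ∀ (r : ℝ), 0 < r →
        (∫⁻ x in sphere (0 : EuclideanSpace ℝ (Fin n)) r,
            (∫⁻ y, ENNReal.ofReal (|P y| / ‖x - y‖ ^ b)) ^ q ∂(μH[(n : ℝ) - 1])) ≤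
          ENNReal.ofReal (C * (∫ y, |P y|) ^ q * r ^ ((n : ℝ) - 1 - b * q)) := by
  obtain ⟨m, rfl⟩ : ∃ m, n = m + 1 := ⟨n - 1, by omega⟩
  have hm : (0 : ℝ) < m := by exact_mod_cast (by omega : 0 < m)
  have hdim : ((m + 1 : ℕ) : ℝ) - 1 = m := by push_cast; ring
  rw [hdim] at hbq ⊢
  have hq0 : 0 < q := by linarith
  have hs : 0 < b * q := by positivity
  set A : ℝ := 2 * (m + 1) * (2 * ((m + 1) * m + m)) ^ m
  have hA0 : 0 < A := by positivity
  set C : ℝ := A * (1 + 2 ^ (b * q) * (1 - (1 / 2) ^ (m - b * q))⁻¹)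
  have hC0 : 0 < C := by
    have : 0 < 1 - (1 / 2 : ℝ) ^ (m - b * q) :=
      sub_pos.2 (Real.rpow_lt_one (by norm_num) (by norm_num) (sub_pos.2 hbq))
    positivity
  refine ⟨C, hC0, fun P hP r hr => ?_⟩
  set σ : Measure (EuclideanSpace ℝ (Fin (m + 1))) := μH[(m : ℝ)].restrict (sphere 0 r) with hσ
  have hball (y) (t : ℝ) (ht : 0 < t) : σ (closedBall y t) ≤ ENNReal.ofReal (A * t ^ (m : ℝ)) := by
    rw [hσ, Measure.restrict_apply measurableSet_closedBall, inter_comm]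
    exact hausdorffMeasure_sphere_inter_closedBall_le m hr ht y
  have huniv : σ univ ≤ ENNReal.ofReal (A * r ^ (m : ℝ)) := by
    have := hausdorffMeasure_sphere_inter_closedBall_le m hr hr 0
    rwa [inter_eq_left.2 sphere_subset_closedBall, ← Measure.restrict_apply_univ] at this
  have : IsFiniteMeasure σ := ⟨huniv.trans_lt ENNReal.ofReal_lt_top⟩
  let F (y : EuclideanSpace ℝ (Fin (m + 1))) : ℝ≥0∞ := ENNReal.ofReal |P y|
  have hF : AEMeasurable F := hP.1.aemeasurable.abs.ennreal_ofReal
  have hI : ∫⁻ y, F y = ENNReal.ofReal (∫ y, |P y|) :=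
    (ofReal_integral_eq_lintegral_ofReal hP.abs (ae_of_all _ fun _ => abs_nonneg _)).symm
  have hsplit (x y : EuclideanSpace ℝ (Fin (m + 1))) :
      ENNReal.ofReal (|P y| / ‖x - y‖ ^ b) = F y * ENNReal.ofReal ((dist x y ^ b)⁻¹) := by
    rw [← ENNReal.ofReal_mul (abs_nonneg _), dist_eq_norm, div_eq_mul_inv]
  have hpow (x y : EuclideanSpace ℝ (Fin (m + 1))) :
      ENNReal.ofReal ((dist x y ^ b)⁻¹) ^ q = ENNReal.ofReal ((dist x y ^ (b * q))⁻¹) := by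
    rw [ENNReal.ofReal_rpow_of_nonneg (by positivity) hq0.le, Real.inv_rpow (by positivity),
      Real.rpow_mul dist_nonneg]
  calc _ ≤ ∫⁻ x, (∫⁻ y, F y) ^ (q - 1) *
          (∫⁻ y, F y * ENNReal.ofReal ((dist x y ^ (b * q))⁻¹)) ∂σ := by
        refine lintegral_mono fun x => ?_
        simp_rw [hsplit, ← hpow]
        exact rpow_lintegral_mul_le hF (by fun_prop) hq
    _ = (∫⁻ y, F y) ^ (q - 1) *
          ∫⁻ x, (∫⁻ y, F y * ENNReal.ofReal ((dist x y ^ (b * q))⁻¹)) ∂σ := by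
        refine lintegral_const_mul' _ _ (ENNReal.rpow_ne_top_of_nonneg (by linarith) ?_)
        rw [hI]
        exact ENNReal.ofReal_ne_top
    _ = (∫⁻ y, F y) ^ (q - 1) *
          ∫⁻ y, F y * (∫⁻ x, ENNReal.ofReal ((dist x y ^ (b * q))⁻¹) ∂σ) := by
        rw [lintegral_lintegral_swap]
        · congr with y
          exact lintegral_const_mul' _ _ ENNReal.ofReal_ne_top
        · exact hF.comp_snd.mul (by fun_prop)
    _ ≤ (∫⁻ y, F y) ^ (q - 1) * ∫⁻ y, F y * ENNReal.ofReal (C * r ^ (m - b * q)) := by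
        gcongr with y
        exact lintegral_inv_dist_rpow_le σ hA0.le hs hbq hr y (hball y) huniv
    _ = (∫⁻ y, F y) ^ q * ENNReal.ofReal (C * r ^ (m - b * q)) := by
        rw [lintegral_mul_const' _ _ ENNReal.ofReal_ne_top, ← mul_assoc]
        congr 1
        conv_rhs => rw [← sub_add_cancel q 1, ENNReal.rpow_add_of_nonneg _ _ (by linarith)
          zero_le_one, ENNReal.rpow_one]
    _ = _ := by
        have hI0 : 0 ≤ ∫ y, |P y| := integral_nonneg fun _ => abs_nonneg _
        rw [hI, ENNReal.ofReal_rpow_of_nonneg hI0 hq0.le, ← ENNReal.ofReal_mul (by positivity)]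
        congr 1
        ring
end

section
/- Let n ≥ 2 be an integer, b > 0 and q ≥ 1 real numbers with b·q < n − 1, and let P ∈ L¹(ℝⁿ). Define u(x) = ∫_{ℝⁿ} |P(y)| / |x − y|^{b} dy. Then there exists a constant C depending only on n, b and q such that for every ρ > 0, ∫_{{x : ρ ≤ |x| ≤ 2ρ}} u(x)^{q} dx ≤ C ‖P‖_{L¹}^{q} ρ^{n−bq}. -/
open MeasureTheory

open scoped ENNReal

/-- Weighted Jensen inequality followed by Tonelli's theorem: if the `q`-th powers of the slices
`k · y` have integral at most `M`, then so does the `q`-th power of an average of these slices,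
up to the total mass of the weight. -/
theorem lintegral_lintegral_mul_rpow_le {α β : Type*} [MeasurableSpace α] [MeasurableSpace β]
    {μ : Measure α} {ν : Measure β} [SFinite μ] [SFinite ν] {f : β → ℝ≥0∞} {k : α → β → ℝ≥0∞}
    {q : ℝ} {M : ℝ≥0∞} (hq : 1 ≤ q) (hf : AEMeasurable f ν) (hf_top : ∫⁻ y, f y ∂ν ≠ ∞)
    (hk : Measurable (Function.uncurry k)) (hM : ∀ y, ∫⁻ x, k x y ^ q ∂μ ≤ M) :
    ∫⁻ x, (∫⁻ y, f y * k x y ∂ν) ^ q ∂μ ≤ (∫⁻ y, f y ∂ν) ^ q * M := by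
  have hq0 : 0 < q := by linarith
  have hq' : 0 ≤ 1 - 1 / q := by
    rw [sub_nonneg, div_le_one hq0]
    exact hq
  have hkx (x : α) : Measurable (k x) := hk.comp measurable_prodMk_left
  have hky (y : β) : Measurable fun x ↦ k x y := hk.comp measurable_prodMk_right
  have jensen (x : α) : (∫⁻ y, f y * k x y ∂ν) ^ q ≤
      (∫⁻ y, f y ∂ν) ^ (q - 1) * ∫⁻ y, f y * k x y ^ q ∂ν := by
    have h := ENNReal.lintegral_mul_norm_pow_le hf (hf.mul ((hkx x).pow_const q).aemeasurable)
      hq' (one_div_nonneg.2 hq0.le) (by ring)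
    have hpt (y : β) : f y ^ (1 - 1 / q) * (f * fun y ↦ k x y ^ q) y ^ (1 / q) = f y * k x y := by
      rw [Pi.mul_apply, ENNReal.mul_rpow_of_nonneg _ _ (one_div_nonneg.2 hq0.le), ← mul_assoc,
        ← ENNReal.rpow_add_of_nonneg _ _ hq' (one_div_nonneg.2 hq0.le), ← ENNReal.rpow_mul,
        mul_one_div_cancel hq0.ne', sub_add_cancel, ENNReal.rpow_one, ENNReal.rpow_one]
    simp_rw [hpt] at h
    refine (ENNReal.rpow_le_rpow h hq0.le).trans_eq ?_
    rw [ENNReal.mul_rpow_of_nonneg _ _ hq0.le, ← ENNReal.rpow_mul, ← ENNReal.rpow_mul,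
      one_div_mul_cancel hq0.ne', ENNReal.rpow_one, sub_mul, one_div_mul_cancel hq0.ne', one_mul]
    rfl
  calc ∫⁻ x, (∫⁻ y, f y * k x y ∂ν) ^ q ∂μ
      ≤ ∫⁻ x, (∫⁻ y, f y ∂ν) ^ (q - 1) * ∫⁻ y, f y * k x y ^ q ∂ν ∂μ := lintegral_mono jensen
    _ = (∫⁻ y, f y ∂ν) ^ (q - 1) * ∫⁻ y, ∫⁻ x, f y * k x y ^ q ∂μ ∂ν := by
      rw [lintegral_const_mul' _ _ (ENNReal.rpow_ne_top_of_nonneg (by linarith) hf_top),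
        lintegral_lintegral_swap]
      exact hf.comp_snd.mul (hk.pow_const q).aemeasurable
    _ ≤ (∫⁻ y, f y ∂ν) ^ (q - 1) * ∫⁻ y, f y * M ∂ν := by
      gcongr with y
      rw [lintegral_const_mul _ ((hky y).pow_const q)]
      gcongr
      exact hM y
    _ = (∫⁻ y, f y ∂ν) ^ q * M := by
      rw [lintegral_mul_const'' _ hf, ← mul_assoc]
      nth_rewrite 2 [← ENNReal.rpow_one (∫⁻ y, f y ∂ν)]
      rw [← ENNReal.rpow_add_of_nonneg _ _ (by linarith) zero_le_one, sub_add_cancel]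

section Haar

variable {E : Type*} [NormedAddCommGroup E] [MeasurableSpace E] [BorelSpace E]
  (μ : Measure E) [μ.IsAddHaarMeasure]

theorem setLIntegral_norm_sub_rpow_neg_le {s : ℝ} (hs : 0 ≤ s) (A : Set E) (y : E) :
    ∫⁻ x in A, ENNReal.ofReal (‖x - y‖ ^ (-s)) ∂μ ≤
      ∫⁻ x in Metric.ball 0 1, ENNReal.ofReal (‖x‖ ^ (-s)) ∂μ + μ A := by
  calc ∫⁻ x in A, ENNReal.ofReal (‖x - y‖ ^ (-s)) ∂μ
      ≤ ∫⁻ x in A, ((Metric.ball (0 : E) 1).indicator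
          (fun x ↦ ENNReal.ofReal (‖x‖ ^ (-s))) (x - y) + 1) ∂μ := by
        refine lintegral_mono fun x ↦ ?_
        by_cases hx : x - y ∈ Metric.ball (0 : E) 1
        · simp [Set.indicator_of_mem hx]
        · rw [Set.indicator_of_notMem hx, zero_add, ENNReal.ofReal_le_one]
          exact Real.rpow_le_one_of_one_le_of_nonpos (by simpa using hx) (by linarith)
    _ ≤ ∫⁻ x, (Metric.ball (0 : E) 1).indicator
          (fun x ↦ ENNReal.ofReal (‖x‖ ^ (-s))) (x - y) ∂μ + μ A := by
        rw [lintegral_add_right _ measurable_const, setLIntegral_one]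
        gcongr
        exact Measure.restrict_le_self
    _ = _ := by
        rw [lintegral_sub_right_eq_self (μ := μ) _ y, lintegral_indicator measurableSet_ball]

variable [NormedSpace ℝ E] [FiniteDimensional ℝ E]

theorem lintegral_eq_mul_lintegral_comp_smul {f : E → ℝ≥0∞} (hf : Measurable f) {r : ℝ}
    (hr : 0 < r) :
    ∫⁻ x, f x ∂μ = ENNReal.ofReal (r ^ Module.finrank ℝ E) * ∫⁻ x, f (r • x) ∂μ := by
  rw [← lintegral_map hf (measurable_const_smul r), Measure.map_addHaar_smul μ hr.ne',
    lintegral_smul_measure, smul_eq_mul, ← mul_assoc, ← ENNReal.ofReal_mul (by positivity),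
    abs_of_pos (by positivity), mul_inv_cancel₀ (by positivity), ENNReal.ofReal_one, one_mul]

theorem setLIntegral_annulus_norm_sub_rpow_neg_le {s : ℝ} (hs : 0 ≤ s) {r : ℝ} (hr : 0 < r)
    (y : E) :
    ∫⁻ x in {x : E | r ≤ ‖x‖ ∧ ‖x‖ ≤ 2 * r}, ENNReal.ofReal (‖x - y‖ ^ (-s)) ∂μ ≤
      ENNReal.ofReal (r ^ (Module.finrank ℝ E - s)) *
        (∫⁻ x in Metric.ball 0 1, ENNReal.ofReal (‖x‖ ^ (-s)) ∂μ + μ (Metric.closedBall 0 2)) := by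
  have hsub : {x : E | r ≤ ‖x‖ ∧ ‖x‖ ≤ 2 * r} ⊆ Metric.closedBall 0 (2 * r) :=
    fun x hx ↦ by simpa using hx.2
  have hmeas : Measurable fun x : E ↦ ENNReal.ofReal (‖x - y‖ ^ (-s)) := by fun_prop
  refine (lintegral_mono_set hsub).trans ?_
  rw [← lintegral_indicator measurableSet_closedBall,
    lintegral_eq_mul_lintegral_comp_smul μ (hmeas.indicator measurableSet_closedBall) hr]
  have hpt (x : E) : (Metric.closedBall (0 : E) (2 * r)).indicator
        (fun x ↦ ENNReal.ofReal (‖x - y‖ ^ (-s))) (r • x) =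
      ENNReal.ofReal (r ^ (-s)) * (Metric.closedBall (0 : E) 2).indicator
        (fun x ↦ ENNReal.ofReal (‖x - r⁻¹ • y‖ ^ (-s))) x := by
    have hmem : r • x ∈ Metric.closedBall (0 : E) (2 * r) ↔ x ∈ Metric.closedBall (0 : E) 2 := by
      simp only [mem_closedBall_zero_iff, norm_smul, Real.norm_of_nonneg hr.le]
      rw [mul_comm, mul_le_mul_iff_left₀ hr]
    by_cases hx : x ∈ Metric.closedBall (0 : E) 2
    · have hxy : r • x - y = r • (x - r⁻¹ • y) := by
        rw [smul_sub, smul_inv_smul₀ hr.ne']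
      rw [Set.indicator_of_mem (hmem.2 hx), Set.indicator_of_mem hx, hxy, norm_smul,
        Real.norm_of_nonneg hr.le, Real.mul_rpow hr.le (norm_nonneg _),
        ENNReal.ofReal_mul (by positivity)]
    · rw [Set.indicator_of_notMem (hmem.not.2 hx), Set.indicator_of_notMem hx, mul_zero]
  simp_rw [hpt]
  rw [lintegral_const_mul' _ _ ENNReal.ofReal_ne_top, lintegral_indicator measurableSet_closedBall,
    ← mul_assoc, ← ENNReal.ofReal_mul (by positivity), ← Real.rpow_natCast, ← Real.rpow_add hr,
    ← sub_eq_add_neg]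
  gcongr
  exact setLIntegral_norm_sub_rpow_neg_le μ hs _ _

theorem setLIntegral_ball_norm_rpow_neg_ne_top {s : ℝ} (hd : 1 ≤ Module.finrank ℝ E)
    (hs : s < Module.finrank ℝ E) (r : ℝ) :
    ∫⁻ x in Metric.ball 0 r, ENNReal.ofReal (‖x‖ ^ (-s)) ∂μ ≠ ∞ := by
  have hmeas : Measurable fun x : E ↦ ‖x‖ ^ (-s) := by fun_prop
  have hint : IntegrableOn (fun x : E ↦ ‖x‖ ^ (-s)) (Metric.ball 0 r) μ := by
    refine integrableOn_ball_of_norm_le_rpow (C := 1) hd hs (.of_forall fun x ↦ ?_)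
      hmeas.aestronglyMeasurable
    rw [one_mul, Real.norm_of_nonneg (by positivity)]
  exact hint.lintegral_lt_top.ne

end Haar

/-- Estimate (4.6) in the proof of Lemma 5.2: annulus estimate for powers of
Riesz potentials of L¹ functions. -/
theorem stmt_7 (n : ℕ) (hn : 2 ≤ n) (b q : ℝ) (hb : 0 < b) (hq : 1 ≤ q)
    (hbq : b * q < (n : ℝ) - 1) :
    ∃ C : ℝ, 0 < C ∧
      ∀ (P : EuclideanSpace ℝ (Fin n) → ℝ), Integrable P →
      ∀ (ρ : ℝ), 0 < ρ →
        (∫⁻ x in {x : EuclideanSpace ℝ (Fin n) | ρ ≤ ‖x‖ ∧ ‖x‖ ≤ 2 * ρ},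
            (∫⁻ y, ENNReal.ofReal (|P y| / ‖x - y‖ ^ b)) ^ q) ≤
          ENNReal.ofReal (C * (∫ y, |P y|) ^ q * ρ ^ ((n : ℝ) - b * q)) := by
  have hs : 0 ≤ b * q := by positivity
  set K : ℝ≥0∞ := (∫⁻ x in Metric.ball (0 : EuclideanSpace ℝ (Fin n)) 1,
    ENNReal.ofReal (‖x‖ ^ (-(b * q)))) +
      volume (Metric.closedBall (0 : EuclideanSpace ℝ (Fin n)) 2)
  have hK_top : K ≠ ∞ := by
    refine ENNReal.add_ne_top.2 ⟨setLIntegral_ball_norm_rpow_neg_ne_top _ ?_ ?_ 1,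
      measure_closedBall_lt_top.ne⟩
    · rw [finrank_euclideanSpace_fin]
      lia
    · rw [finrank_euclideanSpace_fin]
      linarith
  refine ⟨K.toReal + 1, by positivity, fun P hP ρ hρ ↦ ?_⟩
  have hker (x y : EuclideanSpace ℝ (Fin n)) : ENNReal.ofReal (|P y| / ‖x - y‖ ^ b) =
      ENNReal.ofReal |P y| * ENNReal.ofReal (‖x - y‖ ^ (-b)) := by
    rw [← ENNReal.ofReal_mul (abs_nonneg _), Real.rpow_neg (norm_nonneg _), div_eq_mul_inv]
  have hmass : ∫⁻ y, ENNReal.ofReal |P y| = ENNReal.ofReal (∫ y, |P y|) :=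
    (ofReal_integral_eq_lintegral_ofReal hP.abs (.of_forall fun _ ↦ abs_nonneg _)).symm
  have hslice (y : EuclideanSpace ℝ (Fin n)) :
      ∫⁻ x in {x : EuclideanSpace ℝ (Fin n) | ρ ≤ ‖x‖ ∧ ‖x‖ ≤ 2 * ρ},
        ENNReal.ofReal (‖x - y‖ ^ (-b)) ^ q ≤ ENNReal.ofReal (ρ ^ ((n : ℝ) - b * q)) * K := by
    have h := setLIntegral_annulus_norm_sub_rpow_neg_le
      (volume : Measure (EuclideanSpace ℝ (Fin n))) hs hρ y
    rw [finrank_euclideanSpace_fin] at h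
    refine le_of_eq_of_le (lintegral_congr fun x ↦ ?_) h
    rw [ENNReal.ofReal_rpow_of_nonneg (by positivity) (by linarith),
      ← Real.rpow_mul (norm_nonneg _), neg_mul]
  have hmain := lintegral_lintegral_mul_rpow_le (ν := volume) hq
    hP.abs.aestronglyMeasurable.aemeasurable.ennreal_ofReal
    (hmass ▸ ENNReal.ofReal_ne_top) (k := fun x y ↦ ENNReal.ofReal (‖x - y‖ ^ (-b)))
    (by unfold Function.uncurry; fun_prop) hslice
  have hI : 0 ≤ ∫ y, |P y| := integral_nonneg fun _ ↦ abs_nonneg _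
  simp_rw [hker]
  refine hmain.trans ?_
  rw [hmass, ENNReal.ofReal_rpow_of_nonneg hI (by linarith), ENNReal.ofReal_mul (by positivity),
    ENNReal.ofReal_mul (by positivity), mul_comm (ENNReal.ofReal (ρ ^ _)) K, ← mul_assoc,
    mul_comm _ K]
  gcongr
  exact (ENNReal.ofReal_toReal hK_top).symm.trans_le (ENNReal.ofReal_le_ofReal (by linarith))
end

section
/- Let m ≥ 1 be an integer, n = 2m, and let L be a symmetric real n × n matrix. Define R(i,j,k,l) = L_{ik} L_{jl} − L_{il} L_{jk} for indices i,j,k,l ∈ {1,…,n}. Then ∑_{f : {1,…,n} → {1,…,n}} ∑_{π ∈ S_n} sgn(π) ∏_{k=1}^{m} R( f(2k−1), f(2k), f(π(2k−1)), f(π(2k)) ) = 2ⁿ · m! · (n−1)!! · det L, where S_n is the symmetric group on {1,…,n} and (n−1)!! = 1·3·5⋯(n−1). -/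
open Equiv in
/-- Antisymmetrizing the factors of the Leibniz expansion along the pairs
`(e (inl k), e (inr k))`, `k ∈ s`, multiplies the determinant by `2 ^ #s`. -/
theorem Matrix.sum_sign_mul_prod_pair_sub {ι κ R : Type*} [Fintype ι] [DecidableEq ι] [Fintype κ]
    [DecidableEq κ] [CommRing R] (e : κ ⊕ κ ≃ ι) (M : Matrix ι ι R) (s : Finset κ) :
    ∑ π : Perm ι, ((Perm.sign π : ℤ) : R) *
      ((∏ k ∈ s, (M (e (.inl k)) (π (e (.inl k))) * M (e (.inr k)) (π (e (.inr k))) -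
          M (e (.inl k)) (π (e (.inr k))) * M (e (.inr k)) (π (e (.inl k))))) *
        ∏ k ∈ sᶜ, M (e (.inl k)) (π (e (.inl k))) * M (e (.inr k)) (π (e (.inr k)))) =
      2 ^ s.card * M.det := by
  induction s using Finset.induction_on with
  | empty =>
    rw [← Matrix.det_transpose, Matrix.det_apply']
    simp [← Equiv.prod_comp e, Fintype.prod_sum_type, Finset.prod_mul_distrib]
  | insert a s ha ih =>
    have hc : sᶜ = insert a (insert a s)ᶜ := by
      rw [Finset.compl_insert, Finset.insert_erase (Finset.mem_compl.2 ha)]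
    have hac : a ∉ (insert a s)ᶜ := by simp
    simp_rw [hc, Finset.prod_insert hac] at ih
    simp_rw [Finset.prod_insert ha, sub_mul, mul_sub]
    rw [Finset.sum_sub_distrib, Finset.card_insert_of_notMem ha, pow_succ, mul_two, add_mul,
      sub_eq_add_neg, ← Finset.sum_neg_distrib]
    refine congrArg₂ (· + ·) ?_ ?_
    · rw [← ih]
      exact Finset.sum_congr rfl fun π _ ↦ by ring
    · rw [← ih, ← Equiv.sum_comp (Equiv.mulRight (Equiv.swap (e (.inl a)) (e (.inr a))))]
      refine Finset.sum_congr rfl fun π _ ↦ ?_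
      have hfix (k : κ) (hk : k ≠ a) :
          Equiv.swap (e (.inl a)) (e (.inr a)) (e (.inl k)) = e (.inl k) ∧
            Equiv.swap (e (.inl a)) (e (.inr a)) (e (.inr k)) = e (.inr k) :=
        ⟨swap_apply_of_ne_of_ne (by simpa using hk) (by simp),
          swap_apply_of_ne_of_ne (by simp) (by simpa using hk)⟩
      have hne : e (.inl a) ≠ e (.inr a) := by simp
      simp only [coe_mulRight, Perm.sign_mul, Perm.sign_swap hne, Perm.mul_apply,
        swap_apply_left, swap_apply_right]
      rw [Finset.prod_congr rfl fun k hk ↦ by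
          rw [(hfix k (ne_of_mem_of_not_mem hk ha)).1, (hfix k (ne_of_mem_of_not_mem hk ha)).2],
        Finset.prod_congr (s₁ := (insert a s)ᶜ) rfl fun k hk ↦ by
          rw [(hfix k (ne_of_mem_of_not_mem hk hac)).1, (hfix k (ne_of_mem_of_not_mem hk hac)).2]]
      push_cast
      ring

/-- Summing the determinants of all `f`-reindexings of `M` only sees the permutations `f`. -/
theorem Matrix.sum_det_submatrix_self {ι R : Type*} [Fintype ι] [DecidableEq ι] [CommRing R]
    (M : Matrix ι ι R) :
    ∑ f : ι → ι, (M.submatrix f f).det = (Fintype.card ι).factorial * M.det := by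
  classical
  have hperm (σ : Equiv.Perm ι) : (M.submatrix σ σ).det = M.det := M.det_submatrix_equiv_self σ
  rw [← Fintype.card_perm, ← nsmul_eq_mul, ← Finset.card_univ, ← Finset.sum_const,
    ← Finset.sum_congr rfl fun σ _ ↦ hperm σ]
  symm
  refine Finset.sum_of_injOn (fun σ : Equiv.Perm ι ↦ (σ : ι → ι))
    (fun _ _ _ _ h ↦ DFunLike.coe_injective h) (by simp) (fun f _ hf ↦ ?_) fun _ _ ↦ rfl
  have hinj : ¬ Function.Injective f := fun h ↦
    hf ⟨Equiv.ofBijective f (Finite.injective_iff_bijective.1 h), by simp, rfl⟩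
  obtain ⟨i, j, hij, hne⟩ := Function.not_injective_iff.1 hinj
  exact Matrix.det_zero_of_row_eq hne (by ext; simp [hij])

/-- `Fin (2 * m)` splits into its even and odd indices. -/
theorem Fin.exists_sum_equiv_even_odd (m : ℕ) : ∃ e : Fin m ⊕ Fin m ≃ Fin (2 * m),
    ∀ k : Fin m, (e (.inl k) : ℕ) = 2 * k ∧ (e (.inr k) : ℕ) = 2 * k + 1 := by
  let g : Fin m ⊕ Fin m → Fin (2 * m) :=
    Sum.elim (fun k ↦ ⟨2 * k, by omega⟩) fun k ↦ ⟨2 * k + 1, by omega⟩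
  have hg : Function.Bijective g := by
    refine (Fintype.bijective_iff_injective_and_card _).2 ⟨?_, by simp; omega⟩
    rintro (a | a) (b | b) h <;> simp [g, Fin.ext_iff] at h ⊢ <;> omega
  exact ⟨Equiv.ofBijective g hg, fun k ↦ ⟨rfl, rfl⟩⟩

/-- Lemma 5.1: the Pfaffian-type generalized Kronecker delta contraction of the
Gauss-equation curvature `R(i,j,k,l) = L_{ik}L_{jl} - L_{il}L_{jk}` of a symmetric
matrix `L` equals `2ⁿ · (n/2)! · (n-1)!! · det L` for `n = 2m`. -/
theorem stmt_10 (m : ℕ) (hm : 1 ≤ m)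
    (L : Matrix (Fin (2 * m)) (Fin (2 * m)) ℝ) (hL : L.IsSymm) :
    (∑ f : Fin (2 * m) → Fin (2 * m), ∑ π : Equiv.Perm (Fin (2 * m)),
      ((Equiv.Perm.sign π : ℤ) : ℝ) *
        ∏ k : Fin m,
          (L (f ⟨2 * k, by have := k.2; omega⟩) (f (π ⟨2 * k, by have := k.2; omega⟩)) *
             L (f ⟨2 * k + 1, by have := k.2; omega⟩) (f (π ⟨2 * k + 1, by have := k.2; omega⟩)) -
           L (f ⟨2 * k, by have := k.2; omega⟩) (f (π ⟨2 * k + 1, by have := k.2; omega⟩)) *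
             L (f ⟨2 * k + 1, by have := k.2; omega⟩) (f (π ⟨2 * k, by have := k.2; omega⟩)))) =
    2 ^ (2 * m) * (Nat.factorial m : ℝ) * (Nat.doubleFactorial (2 * m - 1) : ℝ) * L.det := by
  have hfact : ((2 * m).factorial : ℝ) =
      2 ^ m * (m.factorial : ℝ) * (Nat.doubleFactorial (2 * m - 1) : ℝ) := by
    obtain ⟨n, rfl⟩ := Nat.exists_eq_add_of_le' hm
    have h := Nat.factorial_eq_mul_doubleFactorial (2 * n + 1)
    rw [show 2 * n + 1 + 1 = 2 * (n + 1) by ring, Nat.doubleFactorial_two_mul] at h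
    rw [show 2 * (n + 1) - 1 = 2 * n + 1 by omega]
    exact_mod_cast h
  obtain ⟨e, he⟩ := Fin.exists_sum_equiv_even_odd m
  have hl (k : Fin m) : e (.inl k) = ⟨2 * k, by omega⟩ := Fin.ext (he k).1
  have hr (k : Fin m) : e (.inr k) = ⟨2 * k + 1, by omega⟩ := Fin.ext (he k).2
  have hdet := L.sum_det_submatrix_self
  rw [Fintype.card_fin, hfact] at hdet
  calc
    _ = ∑ f : Fin (2 * m) → Fin (2 * m), 2 ^ m * (L.submatrix f f).det := by
      refine Finset.sum_congr rfl fun f _ ↦ ?_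
      simpa [hl, hr] using
        Matrix.sum_sign_mul_prod_pair_sub e (L.submatrix f f) Finset.univ
    _ = _ := by
      rw [← Finset.mul_sum, hdet]
      ring
end
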